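/- arXiv:2307.05308 — 3 statements merged into one kernel-verified Lean document; each statement's English description precedes it below -/
import Mathlib

section
/- For any generating triplet {i,j,k} of I, the set P_{i,j,k} = {{i,j},{j,k},{k,i},{i,j∗k},{j,k∗i},{k,i∗j}} is a nice set; moreover the only generating triplet {i',j',k'} with {i',j'} ∈ P_{i,j,k} and {k', i'∗j'} ∈ P_{i,j,k} is {i,j,k} itself. -/
abbrev GG : Type := ZMod 2 × ZMod 2 × ZMod 2

def X : Finset (Sym2 GG) :=
  ((Finset.univ : Finset (GG × GG)).filter
    fun q => q.1 ≠ q.2 ∧ q.1 ≠ 0 ∧ q.2 ≠ 0).image fun q => s(q.1, q.2)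

def Generative (a b c : GG) : Prop :=
  a ≠ 0 ∧ b ≠ 0 ∧ c ≠ 0 ∧ a ≠ b ∧ a ≠ c ∧ b ≠ c ∧ c ≠ a + b

def Pset (a b c : GG) : Finset (Sym2 GG) :=
  {s(a, b), s(b, c), s(c, a), s(a, b + c), s(b, c + a), s(c, a + b)}

def IsNice (T : Finset (Sym2 GG)) : Prop :=
  T ⊆ X ∧ ∀ a b c : GG, Generative a b c →
    s(a, b) ∈ T → s(a + b, c) ∈ T → Pset a b c ⊆ T

theorem mem_Pset_iff {a b c x y : GG} :
    s(x, y) ∈ Pset a b c ↔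
      (x = a ∧ y = b ∨ x = b ∧ y = a) ∨ (x = b ∧ y = c ∨ x = c ∧ y = b) ∨
      (x = c ∧ y = a ∨ x = a ∧ y = c) ∨ (x = a ∧ y = b + c ∨ x = b + c ∧ y = a) ∨
      (x = b ∧ y = c + a ∨ x = c + a ∧ y = b) ∨ (x = c ∧ y = a + b ∨ x = a + b ∧ y = c) := by
  simp [Pset]

theorem Pset_swap (a b c : GG) : Pset b a c = Pset a b c := by
  ext e
  simp only [Pset, Finset.mem_insert, Finset.mem_singleton, Sym2.eq_swap (a := b) (b := a),
    Sym2.eq_swap (a := a) (b := c), Sym2.eq_swap (a := c) (b := b), add_comm b a, add_comm c a,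
    add_comm c b]
  exact Iff.of_eq (by ac_rfl)

theorem Pset_rotate (a b c : GG) : Pset b c a = Pset a b c := by
  ext e
  simp only [Pset, Finset.mem_insert, Finset.mem_singleton]
  exact Iff.of_eq (by ac_rfl)

theorem two_eq_zero_GG : (2 : GG) = 0 := by decide

theorem sum_of_matched_pair {R : Type*} [CommRing R] {i j k x y : R}
    (hxy : (x = i ∧ y = j ∨ x = j ∧ y = i) ∨ (x = j ∧ y = k ∨ x = k ∧ y = j) ∨
      (x = k ∧ y = i ∨ x = i ∧ y = k) ∨ (x = i ∧ y = j + k ∨ x = j + k ∧ y = i) ∨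
      (x = j ∧ y = k + i ∨ x = k + i ∧ y = j) ∨ (x = k ∧ y = i + j ∨ x = i + j ∧ y = k)) :
    (x = i ∧ y = j ∨ x = j ∧ y = i) ∨ (x = j ∧ y = k ∨ x = k ∧ y = j) ∨
      (x = k ∧ y = i ∨ x = i ∧ y = k) ∨ x + y = i + j + k := by
  grind (splits := 30)

theorem ne_of_matched_pair {R : Type*} [CommRing R] (h2 : (2 : R) = 0) {i j k x y : R}
    (hi : i ≠ 0) (hj : j ≠ 0) (hk : k ≠ 0) (hij : i ≠ j) (hik : i ≠ k) (hjk : j ≠ k)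
    (hijk : k ≠ i + j)
    (hxy : (x = i ∧ y = j ∨ x = j ∧ y = i) ∨ (x = j ∧ y = k ∨ x = k ∧ y = j) ∨
      (x = k ∧ y = i ∨ x = i ∧ y = k) ∨ (x = i ∧ y = j + k ∨ x = j + k ∧ y = i) ∨
      (x = j ∧ y = k + i ∨ x = k + i ∧ y = j) ∨ (x = k ∧ y = i + j ∨ x = i + j ∧ y = k)) :
    x ≠ y ∧ x ≠ 0 ∧ y ≠ 0 := by
  grind (splits := 30)

theorem partner_of_sum {R : Type*} [CommRing R] (h2 : (2 : R) = 0) {i j k s z : R}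
    (hi : i ≠ 0) (hj : j ≠ 0) (hk : k ≠ 0) (hij : i ≠ j) (hik : i ≠ k) (hjk : j ≠ k)
    (hijk : k ≠ i + j)
    (hz : (z = i ∧ s = j ∨ z = j ∧ s = i) ∨ (z = j ∧ s = k ∨ z = k ∧ s = j) ∨
      (z = k ∧ s = i ∨ z = i ∧ s = k) ∨ (z = i ∧ s = j + k ∨ z = j + k ∧ s = i) ∨
      (z = j ∧ s = k + i ∨ z = k + i ∧ s = j) ∨ (z = k ∧ s = i + j ∨ z = i + j ∧ s = k)) :
    s ≠ i + j + k ∧ (s = i + j → z = k) ∧ (s = j + k → z = i) ∧ (s = k + i → z = j) := by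
  grind (splits := 30)

/-- A pair in `Pset i j k` whose sum is again matched in `Pset i j k` is one of the three pairs from
`{i, j, k}`, and the partner of its sum is the third element. -/
theorem eq_permutation_of_mem_Pset {i j k x y z : GG} (h : Generative i j k)
    (hxy : s(x, y) ∈ Pset i j k) (hz : s(z, x + y) ∈ Pset i j k) :
    (x = i ∧ y = j ∨ x = j ∧ y = i) ∧ z = k ∨ (x = j ∧ y = k ∨ x = k ∧ y = j) ∧ z = i ∨
      (x = k ∧ y = i ∨ x = i ∧ y = k) ∧ z = j := by
  have h2 := two_eq_zero_GG
  obtain ⟨hi, hj, hk, hij, hik, hjk, hijk⟩ := h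
  rw [mem_Pset_iff] at hxy hz
  obtain ⟨hne, hk', hi', hj'⟩ := partner_of_sum h2 hi hj hk hij hik hjk hijk hz
  rcases sum_of_matched_pair hxy with h | h | h | h
  · exact .inl ⟨h, hk' (by rcases h with ⟨rfl, rfl⟩ | ⟨rfl, rfl⟩ <;> simp [add_comm])⟩
  · exact .inr (.inl ⟨h, hi' (by rcases h with ⟨rfl, rfl⟩ | ⟨rfl, rfl⟩ <;> simp [add_comm])⟩)
  · exact .inr (.inr ⟨h, hj' (by rcases h with ⟨rfl, rfl⟩ | ⟨rfl, rfl⟩ <;> simp [add_comm])⟩)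
  · exact absurd h hne

/-- For a generating triplet `{i,j,k}`, the set `P_{i,j,k}` is nice;
moreover the only generating triplet `{i',j',k'}` with `{i',j'} ∈ P_{i,j,k}` and
`{k', i'∗j'} ∈ P_{i,j,k}` is `{i,j,k}` itself. -/
theorem Pset_isNice_and_unique (i j k : GG) (h : Generative i j k) :
    IsNice (Pset i j k) ∧
    ∀ i' j' k' : GG, Generative i' j' k' →
      s(i', j') ∈ Pset i j k → s(k', i' + j') ∈ Pset i j k →
      ({i', j', k'} : Set GG) = {i, j, k} := by
  have perm {x y z : GG} := eq_permutation_of_mem_Pset (x := x) (y := y) (z := z) h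
  refine ⟨⟨fun e he => ?_, fun a b c _ hab hc => ?_⟩, fun a b c _ hab hc => ?_⟩
  · induction e with
    | _ x y =>
      obtain ⟨hi, hj, hk, hij, hik, hjk, hijk⟩ := h
      have hxy := ne_of_matched_pair two_eq_zero_GG hi hj hk hij hik hjk hijk (mem_Pset_iff.mp he)
      exact Finset.mem_image.mpr ⟨(x, y), by simpa using hxy, rfl⟩
  · rw [Sym2.eq_swap] at hc
    obtain ⟨⟨rfl, rfl⟩ | ⟨rfl, rfl⟩, rfl⟩ | ⟨⟨rfl, rfl⟩ | ⟨rfl, rfl⟩, rfl⟩ |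
      ⟨⟨rfl, rfl⟩ | ⟨rfl, rfl⟩, rfl⟩ := perm hab hc <;>
    grind [Pset_swap, Pset_rotate]
  · obtain ⟨⟨rfl, rfl⟩ | ⟨rfl, rfl⟩, rfl⟩ | ⟨⟨rfl, rfl⟩ | ⟨rfl, rfl⟩, rfl⟩ |
      ⟨⟨rfl, rfl⟩ | ⟨rfl, rfl⟩, rfl⟩ := perm hab hc <;>
    grind
end

section
/- Every nice subset of X with exactly 10 elements is collinear (i.e., mapped by some collineation) to T_{{1,2,3}} := P_{{1,2,3}} ∪ P_{{1,2,1∗3}} ∪ P_{{1,3,1∗2}} ∪ P_{{1,1∗2,1∗3}}. -/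
def IsCollin (σ : GG ≃ GG) : Prop :=
  σ 0 = 0 ∧ ∀ a b : GG, a ≠ 0 → b ≠ 0 → a ≠ b → σ (a + b) = σ a + σ b

def ee1 : GG := (1, 0, 0)
def ee2 : GG := (0, 1, 0)
def ee3 : GG := (0, 0, 1)

/-- `T_{{1,2,3}} = P_{1,2,3} ∪ P_{1,2,1∗3} ∪ P_{1,3,1∗2} ∪ P_{1,1∗2,1∗3}`. -/
def T123 : Finset (Sym2 GG) :=
  Pset ee1 ee2 ee3 ∪ Pset ee1 ee2 (ee1 + ee3) ∪ Pset ee1 ee3 (ee1 + ee2) ∪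
    Pset ee1 (ee1 + ee2) (ee1 + ee3)

instance (a b c : GG) : Decidable (Generative a b c) :=
  inferInstanceAs (Decidable (a ≠ 0 ∧ b ≠ 0 ∧ c ≠ 0 ∧ a ≠ b ∧ a ≠ c ∧ b ≠ c ∧ c ≠ a + b))

/-- The nice set `P_{a,b,c} ∪ P_{a,b,a∗c} ∪ P_{a,c,a∗b} ∪ P_{a,a∗b,a∗c}`. -/
def Tset (a b c : GG) : Finset (Sym2 GG) :=
  Pset a b c ∪ Pset a b (a + c) ∪ Pset a c (a + b) ∪ Pset a (a + b) (a + c)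

lemma Generative.map (σ : GG ≃+ GG) {a b c : GG} (h : Generative a b c) :
    Generative (σ a) (σ b) (σ c) := by
  simpa [Generative, ← map_add] using h

lemma isCollin_addEquiv (σ : GG ≃+ GG) : IsCollin σ.toEquiv :=
  ⟨map_zero σ, fun a b _ _ _ => map_add σ a b⟩

lemma image_Pset (σ : GG ≃+ GG) (a b c : GG) :
    (Pset a b c).image (Sym2.map σ) = Pset (σ a) (σ b) (σ c) := by
  simp [Pset, Finset.image_insert]

lemma image_Tset (σ : GG ≃+ GG) (a b c : GG) :
    (Tset a b c).image (Sym2.map σ) = Tset (σ a) (σ b) (σ c) := by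
  simp [Tset, Finset.image_union, image_Pset]

lemma mem_X {a b : GG} : s(a, b) ∈ X ↔ a ≠ b ∧ a ≠ 0 ∧ b ≠ 0 := by
  revert a b; decide +kernel

lemma mem_image_map_iff (σ : GG ≃+ GG) (T : Finset (Sym2 GG)) (a b : GG) :
    s(σ a, σ b) ∈ T.image (Sym2.map σ) ↔ s(a, b) ∈ T := by
  rw [← Sym2.map_mk]
  exact (Sym2.map.injective σ.injective).mem_finset_image

lemma IsNice.image (σ : GG ≃+ GG) {T : Finset (Sym2 GG)} (hT : IsNice T) :
    IsNice (T.image (Sym2.map σ)) := by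
  refine ⟨?_, fun a b c h hab habc => ?_⟩
  · intro x hx
    obtain ⟨y, hy, rfl⟩ := Finset.mem_image.1 hx
    induction y with
    | _ a b =>
      have := mem_X.1 (hT.1 hy)
      simpa [mem_X] using this
  · obtain ⟨a, rfl⟩ := σ.surjective a
    obtain ⟨b, rfl⟩ := σ.surjective b
    obtain ⟨c, rfl⟩ := σ.surjective c
    rw [← map_add, mem_image_map_iff] at habc
    rw [mem_image_map_iff] at hab
    have h' : Generative a b c := by simpa using h.map σ.symm
    rw [← image_Pset]
    exact Finset.image_subset_image (hT.2 a b c h' hab habc)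

/-- The group `ZMod 2 ^ 3` acts transitively on its bases. -/
lemma Generative.exists_addEquiv {a b c : GG} (h : Generative a b c) :
    ∃ σ : GG ≃+ GG, σ a = ee1 ∧ σ b = ee2 ∧ σ c = ee3 := by
  let τ : GG →+ GG :=
    { toFun := fun v => v.1 • a + v.2.1 • b + v.2.2 • c
      map_zero' := by simp
      map_add' := fun v w => by simp only [Prod.fst_add, Prod.snd_add, add_smul]; abel }
  have hτ : Function.Bijective τ := by
    rw [← Finite.injective_iff_bijective, injective_iff_map_eq_zero]
    have key : ∀ a b c : GG, Generative a b c → ∀ v : GG,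
        v.1 • a + v.2.1 • b + v.2.2 • c = 0 → v = 0 := by decide +kernel
    exact key a b c h
  refine ⟨(AddEquiv.ofBijective τ hτ).symm, ?_, ?_, ?_⟩ <;>
    rw [AddEquiv.symm_apply_eq] <;> simp [τ, ee1, ee2, ee3]

/-- Any two edges of this triple force a nice set containing them to contain some `Pset`. -/
def triangle (u v w : GG) : Finset (Sym2 GG) :=
  {s(u, v), s(u + v, w), s(u + v + w, u + w)}

lemma IsNice.exists_Pset_of_triangle {T : Finset (Sym2 GG)} (hT : IsNice T) {u v w : GG}
    (h : Generative u v w) (hcard : 1 < (T ∩ triangle u v w).card) :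
    ∃ a b c, Generative a b c ∧ Pset a b c ⊆ T := by
  have gen : ∀ u v w : GG, Generative u v w → Generative (u + v) w (u + w) ∧
      Generative (u + v + w) (u + w) u ∧ (u + v + w) + (u + w) = v := by decide +kernel
  obtain ⟨h₁, h₂, hv⟩ := gen u v w h
  have p₁ : s(u, v) ∈ T → s(u + v, w) ∈ T → ∃ a b c, Generative a b c ∧ Pset a b c ⊆ T :=
    fun x y => ⟨u, v, w, h, hT.2 _ _ _ h x y⟩
  have p₂ : s(u + v, w) ∈ T → s(u + v + w, u + w) ∈ T →
      ∃ a b c, Generative a b c ∧ Pset a b c ⊆ T :=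
    fun x y => ⟨_, _, _, h₁, hT.2 _ _ _ h₁ x y⟩
  have p₃ : s(u + v + w, u + w) ∈ T → s(u, v) ∈ T →
      ∃ a b c, Generative a b c ∧ Pset a b c ⊆ T :=
    fun x y => ⟨_, _, _, h₂, hT.2 _ _ _ h₂ x (by rwa [hv, Sym2.eq_swap])⟩
  obtain ⟨x, hx, y, hy, hxy⟩ := Finset.one_lt_card.1 hcard
  simp only [triangle, Finset.mem_inter, Finset.mem_insert, Finset.mem_singleton] at hx hy
  obtain ⟨hx, rfl | rfl | rfl⟩ := hx <;> obtain ⟨hy, rfl | rfl | rfl⟩ := hy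
  exacts [absurd rfl hxy, p₁ hx hy, p₃ hy hx, p₁ hy hx, absurd rfl hxy, p₂ hx hy,
    p₃ hx hy, p₂ hy hx, absurd rfl hxy]

/-- Multiplication by a primitive element of the field with eight elements. -/
def singer (v : GG) : GG := (v.2.2, v.1 + v.2.2, v.2.1)

/-- The orbit of a triangle under the Singer cycle. -/
def singerTriangle (i : Fin 7) : Finset (Sym2 GG) :=
  triangle (singer^[i] ee1) (singer^[i] ee2) (singer^[i] (ee1 + ee3))

lemma X_subset_biUnion_singerTriangle :
    X ⊆ (Finset.univ : Finset (Fin 7)).biUnion singerTriangle := by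
  decide +kernel

lemma IsNice.exists_Pset {T : Finset (Sym2 GG)} (hT : IsNice T) (hcard : 7 < T.card) :
    ∃ a b c, Generative a b c ∧ Pset a b c ⊆ T := by
  have gen : ∀ i : Fin 7, Generative (singer^[i] ee1) (singer^[i] ee2)
      (singer^[i] (ee1 + ee3)) := by decide +kernel
  by_contra hP
  have hle : ∀ i ∈ (Finset.univ : Finset (Fin 7)), (T ∩ singerTriangle i).card ≤ 1 :=
    fun i _ => not_lt.1 fun hi => hP (hT.exists_Pset_of_triangle (gen i) hi)
  have := Finset.card_biUnion_le_card_mul _ _ _ hle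
  rw [← Finset.inter_biUnion,
    Finset.inter_eq_left.2 (hT.1.trans X_subset_biUnion_singerTriangle)] at this
  simp at this
  omega

/-- The edges obtained from `S` by one round of the closure condition of nice sets. -/
def niceStep (S : Finset (Sym2 GG)) : Finset (Sym2 GG) :=
  ((Finset.univ : Finset (GG × GG)).filter fun p => s(p.1, p.2) ∈ S).biUnion fun p =>
    ((Finset.univ : Finset GG).filter fun c =>
      Generative p.1 p.2 c ∧ s(p.1 + p.2, c) ∈ S).biUnion fun c => Pset p.1 p.2 c

lemma IsNice.niceStep_subset {S T : Finset (Sym2 GG)} (hT : IsNice T) (hST : S ⊆ T) :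
    niceStep S ⊆ T := by
  refine Finset.biUnion_subset.2 fun p hp => Finset.biUnion_subset.2 fun c hc => ?_
  obtain ⟨hg, h⟩ := (Finset.mem_filter.1 hc).2
  exact hT.2 _ _ _ hg (hST (Finset.mem_filter.1 hp).2) (hST h)

lemma Tset_subset_niceStep : ∀ x ∈ X, x ∉ Pset ee1 ee2 ee3 →
    Tset ee1 ee2 ee3 ⊆ niceStep (insert x (Pset ee1 ee2 ee3)) ∨
    Tset ee2 ee3 ee1 ⊆ niceStep (insert x (Pset ee1 ee2 ee3)) ∨
    Tset ee3 ee1 ee2 ⊆ niceStep (insert x (Pset ee1 ee2 ee3)) := by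
  decide +kernel

lemma IsNice.eq_Tset {T : Finset (Sym2 GG)} (hT : IsNice T) (hcard : T.card = 10)
    (hP : Pset ee1 ee2 ee3 ⊆ T) :
    ∃ a b c, Generative a b c ∧ Tset a b c = T := by
  obtain ⟨x, hx, hxP⟩ : ∃ x ∈ T, x ∉ Pset ee1 ee2 ee3 :=
    Finset.exists_mem_notMem_of_card_lt_card (by rw [hcard]; decide +kernel)
  have hsub := hT.niceStep_subset (Finset.insert_subset hx hP)
  obtain h | h | h := Tset_subset_niceStep x (hT.1 hx) hxP
  · exact ⟨_, _, _, by decide, Finset.eq_of_subset_of_card_le (h.trans hsub)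
      (by rw [hcard]; decide +kernel)⟩
  · exact ⟨_, _, _, by decide, Finset.eq_of_subset_of_card_le (h.trans hsub)
      (by rw [hcard]; decide +kernel)⟩
  · exact ⟨_, _, _, by decide, Finset.eq_of_subset_of_card_le (h.trans hsub)
      (by rw [hcard]; decide +kernel)⟩

/-- Every nice subset of `X` with exactly 10 elements is collinear
(mapped by some collineation) to `T_{{1,2,3}}`. -/
theorem nice_card_ten_collinear (T : Finset (Sym2 GG)) (hT : IsNice T)
    (hcard : T.card = 10) :
    ∃ σ : GG ≃ GG, IsCollin σ ∧ T.image (Sym2.map ⇑σ) = T123 := by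
  obtain ⟨a, b, c, habc, hP⟩ := hT.exists_Pset (by omega)
  obtain ⟨σ, ha, hb, hc⟩ := habc.exists_addEquiv
  have hP' : Pset ee1 ee2 ee3 ⊆ T.image (Sym2.map σ) := by
    rw [← ha, ← hb, ← hc, ← image_Pset]
    exact Finset.image_subset_image hP
  obtain ⟨a', b', c', habc', hT'⟩ := (hT.image σ).eq_Tset
    (by rw [Finset.card_image_of_injective _ (Sym2.map.injective σ.injective), hcard]) hP'
  obtain ⟨τ, ha', hb', hc'⟩ := habc'.exists_addEquiv
  refine ⟨(σ.trans τ).toEquiv, isCollin_addEquiv _, ?_⟩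
  calc T.image (Sym2.map (σ.trans τ).toEquiv)
      = (T.image (Sym2.map σ)).image (Sym2.map τ) := by
        rw [Finset.image_image, ← Sym2.map_comp]; rfl
    _ = T123 := by rw [← hT', image_Tset, ha', hb', hc']; rfl
end

section
/- The total number of nice subsets of X is 779. -/
open Finset

/-- The `n`-th element of `GG`, read off from the binary digits of `n`. -/
def point (n : ℕ) : GG := (n, (n / 2 : ℕ), (n / 4 : ℕ))

/-- The elements of `X`, listed so that pairs completed by the same third point are consecutive. -/
def edges : List (Sym2 GG) :=
  [(2, 3), (4, 5), (6, 7), (1, 3), (4, 6), (5, 7), (1, 2), (4, 7), (5, 6), (1, 5), (2, 6), (3, 7),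
   (1, 4), (2, 7), (3, 6), (1, 7), (2, 4), (3, 5), (1, 6), (2, 5), (3, 4)].map
    fun q : ℕ × ℕ => s(point q.1, point q.2)

def edgeBit (e : Sym2 GG) : ℕ := 2 ^ edges.idxOf e

def premiseMask (a b c : GG) : ℕ := edgeBit s(a, b) ||| edgeBit s(a + b, c)

def psetMask (a b c : GG) : ℕ :=
  edgeBit s(a, b) ||| edgeBit s(b, c) ||| edgeBit s(c, a) ||| edgeBit s(a, b + c) |||
    edgeBit s(b, c + a) ||| edgeBit s(c, a + b)

/-- The values of `(premiseMask a b c, psetMask a b c)` over all generating triplets. -/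
def rules : List (ℕ × ℕ) :=
  [(10, 1179706), (12, 18492), (17, 1064983), (33, 133159), (66, 590274), (68, 9668), (80, 266704),
   (96, 33760), (129, 73863), (136, 37048), (257, 525575), (264, 262968), (513, 658945),
   (516, 3876), (528, 262968), (640, 33760), (1026, 525575), (1032, 282120), (1056, 3876),
   (1152, 9668), (2050, 133159), (2064, 18492), (2112, 44608), (2304, 3876), (4097, 1142785),
   (4100, 28820), (4128, 37048), (4352, 266704), (5120, 291904), (6144, 63496), (8194, 73863),
   (8200, 63496), (8208, 28820), (8448, 9668), (8704, 44608), (16386, 1064983), (16416, 18492),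
   (16448, 291904), (16512, 28820), (16896, 282120), (32769, 239617), (32770, 229538),
   (32784, 37048), (33024, 33760), (33792, 44608), (49152, 63496), (65540, 73863),
   (65544, 1282056), (65568, 229538), (65792, 590274), (66048, 754240), (67584, 239617),
   (81920, 1142785), (131076, 133159), (131088, 1179706), (131136, 754240), (131200, 229538),
   (132096, 658945), (135168, 1282056), (139264, 239617), (262145, 1852417), (262146, 1835282),
   (262176, 262968), (262272, 266704), (264192, 282120), (270336, 291904), (327680, 1904704),
   (393216, 1966600), (524292, 525575), (524296, 1966600), (524304, 1835282), (524416, 590274),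
   (526336, 658945), (528384, 1904704), (540672, 1852417), (557056, 754240), (1048580, 1064983),
   (1048608, 1179706), (1048640, 1904704), (1048832, 1835282), (1049088, 1966600),
   (1049600, 1852417), (1056768, 1142785), (1081344, 1282056)]

/-- The subset of `X` encoded by the binary digits of `m`. -/
def ofMask (m : ℕ) : Finset (Sym2 GG) := X.filter fun e => m.testBit (edges.idxOf e)

/-- `lo` and `hi` are bitwise bounds for a mask; a rule is respected when its premise is not forced
by `lo` or its conclusion is not excluded by `hi`. -/
def respects (rs : List (ℕ × ℕ)) (lo hi : ℕ) : Bool :=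
  rs.all fun r => !(r.1 &&& lo).beq r.1 || (r.2 &&& hi).beq r.2

/-- Counts the masks with leading part `c` and `k` further binary digits which respect the rules.
Inner nodes check only the rules that involve the last digit decided. -/
def search : ℕ → ℕ → ℕ
  | 0, c => if respects rules c c then 1 else 0
  | k + 1, c =>
    if respects (rules.filter fun r => r.2.testBit (k + 1))
        (2 ^ (k + 1) * c) (2 ^ (k + 1) * c + (2 ^ (k + 1) - 1)) then
      search k (2 * c) + search k (2 * c + 1)
    else 0

theorem land_eq_left_iff (x m : ℕ) :
    x &&& m = x ↔ ∀ i, x.testBit i = true → m.testBit i = true := by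
  refine ⟨fun h i hi => ?_, fun h => Nat.eq_of_testBit_eq fun i => ?_⟩
  · rw [← h, Nat.testBit_land, Bool.and_eq_true] at hi
    exact hi.2
  · have := h i
    rw [Nat.testBit_land]
    cases hx : x.testBit i <;> simp_all

theorem lor_land_eq_left_iff (x y m : ℕ) :
    (x ||| y) &&& m = x ||| y ↔ x &&& m = x ∧ y &&& m = y := by
  simp only [land_eq_left_iff, Nat.testBit_lor, Bool.or_eq_true, or_imp, forall_and]

theorem edgeBit_land_eq_left_iff (e : Sym2 GG) (m : ℕ) :
    edgeBit e &&& m = edgeBit e ↔ m.testBit (edges.idxOf e) = true := by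
  simp [land_eq_left_iff, edgeBit, Nat.testBit_two_pow]

theorem respects_iff (rs : List (ℕ × ℕ)) (lo hi : ℕ) :
    respects rs lo hi = true ↔ ∀ r ∈ rs, r.1 &&& lo = r.1 → r.2 &&& hi = r.2 := by
  simp only [respects, List.all_eq_true, Bool.or_eq_true, Bool.not_eq_true', Nat.beq_eq,
    ← Bool.not_eq_true, imp_iff_not_or]

theorem respects_mono {rs rs' : List (ℕ × ℕ)} {lo hi m : ℕ} (hrs : rs ⊆ rs')
    (hlo : lo &&& m = lo) (hhi : m &&& hi = m)
    (h : respects rs' m m = true) : respects rs lo hi = true := by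
  rw [respects_iff] at h ⊢
  intro r hr hp
  rw [land_eq_left_iff] at *
  have := h r (hrs hr)
  rw [land_eq_left_iff, land_eq_left_iff] at this
  exact fun i hi => hhi i (this (fun j hj => hlo j (hp j hj)) i hi)

theorem search_eq_count (k c : ℕ) :
    search k c =
      Nat.count (fun t => respects rules (2 ^ k * c + t) (2 ^ k * c + t) = true) (2 ^ k) := by
  induction k generalizing c with
  | zero =>
    simp only [search, Nat.count_eq_card_filter_range, pow_zero, one_mul, range_one,
      filter_singleton, add_zero]
    split_ifs <;> rfl
  | succ k ih =>
    rw [search]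
    split_ifs with h
    · have h₂ : 2 ^ (k + 1) = 2 ^ k + 2 ^ k := by rw [pow_succ, mul_two]
      rw [ih, ih, h₂, Nat.count_add]
      simp only [mul_add, ← mul_assoc, ← two_mul, mul_one, add_assoc, mul_comm (2 ^ k) 2]
    · symm
      rw [Nat.count_eq_card_filter_range, card_eq_zero, filter_eq_empty_iff]
      intro t ht hm
      rw [Finset.mem_range] at ht
      refine h (respects_mono (List.filter_subset_self _) ?_ ?_ hm) <;>
        rw [land_eq_left_iff] <;> intro i
      · have := Nat.testBit_two_pow_mul_add c (Nat.two_pow_pos (k + 1)) i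
        rw [add_zero] at this
        rw [this, Nat.testBit_two_pow_mul_add c ht]
        split_ifs <;> simp
      · rw [Nat.testBit_two_pow_mul_add c ht,
          Nat.testBit_two_pow_mul_add c (Nat.sub_one_lt (Nat.two_pow_pos _).ne')]
        split_ifs with hi <;> simp [hi]

instance inst_s15 (a b c : GG) : Decidable (Generative a b c) := by
  unfold Generative
  infer_instance

theorem masks_mem_rules (a b c : GG) :
    Generative a b c → (premiseMask a b c, psetMask a b c) ∈ rules := by
  revert a b c
  decide +kernel

theorem exists_generative_of_mem_rules :
    ∀ r ∈ rules, ∃ a b c, Generative a b c ∧ (premiseMask a b c, psetMask a b c) = r := by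
  decide +kernel

theorem Generative.subset_X {a b c : GG} :
    Generative a b c → insert s(a + b, c) (Pset a b c) ⊆ X := by
  revert a b c
  decide +kernel

theorem isNice_ofMask_iff (m : ℕ) : IsNice (ofMask m) ↔ respects rules m m = true := by
  have key (a b c : GG) (h : Generative a b c) :
      (s(a, b) ∈ ofMask m → s(a + b, c) ∈ ofMask m → Pset a b c ⊆ ofMask m) ↔
        (premiseMask a b c &&& m = premiseMask a b c → psetMask a b c &&& m = psetMask a b c) := by
    have hX := h.subset_X
    simp only [Pset, insert_subset_iff, singleton_subset_iff] at hX
    simp only [Pset, insert_subset_iff, singleton_subset_iff, ofMask, mem_filter, premiseMask,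
      psetMask, lor_land_eq_left_iff, edgeBit_land_eq_left_iff, hX, true_and, and_imp, and_assoc]
  rw [respects_iff]
  constructor
  · rintro ⟨-, h⟩ r hr
    obtain ⟨a, b, c, hg, rfl⟩ := exists_generative_of_mem_rules r hr
    exact (key a b c hg).1 (h a b c hg)
  · exact fun h => ⟨filter_subset _ _, fun a b c hg =>
      (key a b c hg).2 (h _ (masks_mem_rules a b c hg))⟩

theorem exists_edge : ∀ j < 21, ∃ e ∈ X, edges.idxOf e = j := by
  decide +kernel

theorem card_X : X.card = 21 := by
  decide +kernel

theorem ofMask_injOn : Set.InjOn ofMask (range (2 ^ 21)) := by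
  intro m hm n hn h
  rw [mem_coe, Finset.mem_range] at hm hn
  refine Nat.eq_of_testBit_eq fun j => ?_
  rcases lt_or_ge j 21 with hj | hj
  · obtain ⟨e, he, rfl⟩ := exists_edge j hj
    have := congrArg (e ∈ ·) h
    simpa [ofMask, he] using this
  · have hle : 2 ^ 21 ≤ 2 ^ j := Nat.pow_le_pow_right two_pos hj
    rw [Nat.testBit_lt_two_pow (hm.trans_le hle), Nat.testBit_lt_two_pow (hn.trans_le hle)]

theorem image_ofMask : (range (2 ^ 21)).image ofMask = X.powerset := by
  refine eq_of_subset_of_card_le ?_ ?_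
  · exact image_subset_iff.2 fun m _ => mem_powerset.2 (filter_subset _ _)
  · rw [card_image_of_injOn ofMask_injOn, card_powerset, card_X, card_range]

theorem search_eq : search 21 0 = 779 := by
  decide +kernel

open Classical in
/-- The total number of nice subsets of `X` is 779. -/
theorem card_nice_sets : (X.powerset.filter IsNice).card = 779 := by
  rw [← image_ofMask, filter_image, card_image_of_injOn
    (ofMask_injOn.mono (coe_subset.2 (filter_subset _ _))), ← search_eq, search_eq_count,
    Nat.count_eq_card_filter_range]
  simp only [isNice_ofMask_iff, mul_zero, zero_add]
end
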